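/- arXiv:0912.2362 — 3 statements merged into one kernel-verified Lean document; each statement's English description precedes it below -/
import Mathlib

section
/- Let N ≥ 2, let 0 < p < 1 be real, q = 1 − p, let y_1 < y_2 < … < y_N be integers, and let r > 0 satisfy r + q r² < p. Then the function u defined by the N-fold contour-integral Bethe-ansatz formula satisfies, for every t ∈ ℝ, every (x_1,…,x_N) ∈ ℤ^N and every i with 1 ≤ i ≤ N−1, the boundary condition u(x_1,…,x_{i−1}, x_i, x_i + 1, x_{i+2},…,x_N; t) = p·u(x_1,…,x_{i−1}, x_i, x_i, x_{i+2},…,x_N; t) + q·u(x_1,…,x_{i−1}, x_i + 1, x_i + 1, x_{i+2},…,x_N; t). -/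
open Finset

noncomputable section

/-- The Bethe-ansatz two-particle factor `S_{αβ}` evaluated at `a = ξ_α`, `b = ξ_β`. -/
def Sfac (p q a b : ℂ) : ℂ := -(p + q * a * b - a) / (p + q * a * b - b)

/-- `A_σ`, the product of `S_{αβ}` over all inversions `(α,β) = (σ(i),σ(j))`, `i < j`,
`σ(i) > σ(j)`, of the permutation `σ`. -/
def Aperm {N : ℕ} (p q : ℂ) (ξ : Fin N → ℂ) (σ : Equiv.Perm (Fin N)) : ℂ :=
  ∏ pr ∈ Finset.univ.filter (fun pr : Fin N × Fin N => pr.1 < pr.2 ∧ σ pr.2 < σ pr.1),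
    Sfac p q (ξ (σ pr.1)) (ξ (σ pr.2))

/-- `ε(ξ) = p ξ⁻¹ + q ξ - 1`. -/
def epsATW (p q ξ : ℂ) : ℂ := p * ξ⁻¹ + q * ξ - 1

/-- Iterated contour integral over `n` copies of the circle `|ξ| = r`
(counterclockwise, centered at 0), without the `(2πi)⁻ⁿ` normalization. -/
def multiCircleIntegral : (n : ℕ) → ((Fin n → ℂ) → ℂ) → ℝ → ℂ
  | 0, f, _ => f ![]
  | n + 1, f, r => ∮ z in C(0, r), multiCircleIntegral n (fun ξ => f (Fin.cons z ξ)) r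

/-- The Bethe-ansatz contour-integral formula
`u(X;t) = Σ_σ (2πi)^{-N} ∮⋯∮ A_σ Π_i ξ_{σ(i)}^{x_i - y_{σ(i)} - 1} e^{Σ_i ε(ξ_i) t} dξ`. -/
def betheU {N : ℕ} (p q : ℂ) (y : Fin N → ℤ) (r : ℝ) (X : Fin N → ℤ) (t : ℝ) : ℂ :=
  ∑ σ : Equiv.Perm (Fin N),
    (2 * (Real.pi : ℂ) * Complex.I)⁻¹ ^ N *
      multiCircleIntegral N
        (fun ξ => Aperm p q ξ σ * (∏ i, ξ (σ i) ^ (X i - y (σ i) - 1)) *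
          Complex.exp ((∑ i, epsATW p q (ξ i)) * (t : ℂ))) r


/-- A function continuous on the torus `∀ k, ‖ξ k‖ = r` is torus integrable. -/
theorem torusIntegrable_of_continuousOn {n : ℕ} {f : (Fin n → ℂ) → ℂ} {r : ℝ} (hr : 0 ≤ r)
    (hf : ContinuousOn f {ξ | ∀ k, ‖ξ k‖ = r}) :
    TorusIntegrable f 0 (fun _ => r) := by
  refine ContinuousOn.integrableOn_compact isCompact_Icc (Continuous.continuousOn ?_)
  refine hf.comp_continuous (by unfold torusMap; fun_prop) fun θ k => ?_
  simp [torusMap, abs_of_nonneg hr]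

theorem torusIntegral_congr_on_torus {n : ℕ} {f g : (Fin n → ℂ) → ℂ} {r : ℝ} (hr : 0 ≤ r)
    (hfg : ∀ ξ : Fin n → ℂ, (∀ k, ‖ξ k‖ = r) → f ξ = g ξ) :
    torusIntegral f 0 (fun _ => r) = torusIntegral g 0 (fun _ => r) := by
  unfold torusIntegral
  congr 1
  funext θ
  rw [hfg]
  intro k
  simp [torusMap, abs_of_nonneg hr]

theorem multiCircleIntegral_eq_torusIntegral {n : ℕ} {f : (Fin n → ℂ) → ℂ} {r : ℝ} (hr : 0 ≤ r)
    (hf : ContinuousOn f {ξ | ∀ k, ‖ξ k‖ = r}) :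
    multiCircleIntegral n f r = torusIntegral f 0 (fun _ => r) := by
  induction n with
  | zero =>
    rw [torusIntegral_dim0]
    exact congrArg f (Subsingleton.elim _ _)
  | succ n ih =>
    rw [torusIntegral_succ (torusIntegrable_of_continuousOn hr hf)]
    refine circleIntegral.integral_congr hr fun z hz => ?_
    refine ih (hf.comp (by fun_prop) fun ξ hξ => ?_)
    refine Fin.cases ?_ ?_
    · simpa using hz
    · simpa using hξ

/-- The denominators of the Bethe factors do not vanish on the torus. -/
theorem Sfac_denom_ne_zero {p q r : ℝ} (hp : 0 < p) (hq : 0 ≤ q) (h : r + q * r ^ 2 < p)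
    {a b : ℂ} (ha : ‖a‖ = r) (hb : ‖b‖ = r) :
    (p : ℂ) + q * a * b - b ≠ 0 := by
  intro h0
  have h1 : (p : ℂ) = b - q * a * b := by linear_combination h0
  have h2 : ‖(p : ℂ)‖ ≤ ‖b‖ + ‖(q : ℂ) * a * b‖ := h1 ▸ norm_sub_le _ _
  simp only [norm_mul, Complex.norm_real, Real.norm_eq_abs, abs_of_pos hp, abs_of_nonneg hq,
    ha, hb] at h2
  nlinarith

theorem swap_lt_swap_iff_of_adjacent {N : ℕ} {i j : Fin N} (hij : (j : ℕ) = i + 1)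
    {a b : Fin N} (h : ¬(a = i ∧ b = j)) (h' : ¬(a = j ∧ b = i)) :
    Equiv.swap i j a < Equiv.swap i j b ↔ a < b := by
  simp only [Equiv.swap_apply_def]
  grind

/-- Composing with an adjacent transposition that creates an inversion adds one factor. -/
theorem Aperm_mul_swap {N : ℕ} (p q : ℂ) (ξ : Fin N → ℂ) (σ : Equiv.Perm (Fin N)) {i j : Fin N}
    (hij : (j : ℕ) = i + 1) (hσ : σ i < σ j) :
    Aperm p q ξ (σ * Equiv.swap i j) = Sfac p q (ξ (σ j)) (ξ (σ i)) * Aperm p q ξ σ := by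
  have hlt : i < j := by rw [Fin.lt_def]; omega
  let inv : Equiv.Perm (Fin N) → Finset (Fin N × Fin N) := fun τ =>
    Finset.univ.filter fun pr => pr.1 < pr.2 ∧ τ pr.2 < τ pr.1
  let e := (Equiv.swap i j).prodCongr (Equiv.swap i j)
  have hmem : ∀ τ a b, (a, b) ∈ inv τ ↔ a < b ∧ τ b < τ a := by simp [inv]
  have hinv : inv (σ * Equiv.swap i j) = insert (i, j) ((inv σ).map e.toEmbedding) := by
    ext ⟨a, b⟩
    simp only [hmem, e, Finset.mem_insert, Finset.mem_map_equiv, Equiv.Perm.mul_apply, Equiv.prodCongr_symm, Equiv.symm_swap,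
      Equiv.prodCongr_apply, Prod.map, Prod.mk.injEq]
    by_cases h : a = i ∧ b = j
    · obtain ⟨rfl, rfl⟩ := h
      simp [hlt, hσ]
    by_cases h' : a = j ∧ b = i
    · obtain ⟨rfl, rfl⟩ := h'
      simp [hlt.not_gt, hσ.not_gt, hlt.ne']
    · simp [h, swap_lt_swap_iff_of_adjacent hij h h']
  have hnot : (i, j) ∉ (inv σ).map e.toEmbedding := by
    simp [hmem, e, Finset.mem_map_equiv, hlt.not_gt]
  change ∏ pr ∈ inv (σ * Equiv.swap i j), _ = _ * ∏ pr ∈ inv σ, _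
  rw [hinv, Finset.prod_insert hnot, Finset.prod_map]
  simp [e]

theorem prod_zpow_update_add_one {N : ℕ} (y X : Fin N → ℤ) (ξ : Fin N → ℂ)
    (σ : Equiv.Perm (Fin N)) (j : Fin N) (hξ : ξ (σ j) ≠ 0) :
    ∏ k, ξ (σ k) ^ (Function.update X j (X j + 1) k - y (σ k) - 1) =
      (∏ k, ξ (σ k) ^ (X k - y (σ k) - 1)) * ξ (σ j) := by
  rw [← Finset.mul_prod_erase _ _ (Finset.mem_univ j),
    ← Finset.mul_prod_erase _ (fun k => ξ (σ k) ^ (X k - y (σ k) - 1)) (Finset.mem_univ j),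
    Finset.prod_congr rfl fun k hk => by rw [Function.update_of_ne (Finset.ne_of_mem_erase hk)],
    Function.update_self, show X j + 1 - y (σ j) - 1 = X j - y (σ j) - 1 + 1 by ring,
    zpow_add_one₀ hξ]
  ring

theorem prod_zpow_mul_swap {N : ℕ} (y X : Fin N → ℤ) (ξ : Fin N → ℂ)
    (σ : Equiv.Perm (Fin N)) {i j : Fin N} (hX : X i = X j) :
    ∏ k, ξ ((σ * Equiv.swap i j) k) ^ (X k - y ((σ * Equiv.swap i j) k) - 1) =
      ∏ k, ξ (σ k) ^ (X k - y (σ k) - 1) := by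
  rw [← Equiv.prod_comp (Equiv.swap i j) fun k => ξ (σ k) ^ (X k - y (σ k) - 1)]
  refine Finset.prod_congr rfl fun k _ => ?_
  have : X (Equiv.swap i j k) = X k := by
    rw [Equiv.swap_apply_def]
    split_ifs <;> simp_all
  rw [this, Equiv.Perm.mul_apply]

/-- The integrand of the Bethe-ansatz formula. -/
def betheIntegrand {N : ℕ} (p q : ℂ) (y X : Fin N → ℤ) (t : ℝ) (σ : Equiv.Perm (Fin N))
    (ξ : Fin N → ℂ) : ℂ :=
  Aperm p q ξ σ * (∏ i, ξ (σ i) ^ (X i - y (σ i) - 1)) *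
    Complex.exp ((∑ i, epsATW p q (ξ i)) * (t : ℂ))

theorem continuousOn_betheIntegrand {N : ℕ} {p q r : ℝ} (hp : 0 < p) (hq : 0 ≤ q) (hr : 0 < r)
    (h : r + q * r ^ 2 < p) (y X : Fin N → ℤ) (t : ℝ) (σ : Equiv.Perm (Fin N)) :
    ContinuousOn (betheIntegrand p q y X t σ) {ξ | ∀ k, ‖ξ k‖ = r} := by
  have hne : ∀ ξ ∈ {ξ : Fin N → ℂ | ∀ k, ‖ξ k‖ = r}, ∀ k, ξ k ≠ 0 := fun ξ hξ k =>
    norm_ne_zero_iff.mp ((hξ k).trans_ne hr.ne')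
  have hcont : ∀ k, ContinuousOn (fun ξ : Fin N → ℂ => ξ k) {ξ | ∀ k, ‖ξ k‖ = r} :=
    fun k => (continuous_apply k).continuousOn
  unfold betheIntegrand Aperm Sfac epsATW
  refine ContinuousOn.mul (ContinuousOn.mul ?_ ?_) (ContinuousOn.cexp (ContinuousOn.mul ?_ ?_))
  · refine continuousOn_finsetProd _ fun pr _ => ContinuousOn.div (by fun_prop) (by fun_prop) ?_
    exact fun ξ hξ => Sfac_denom_ne_zero hp hq h (hξ _) (hξ _)
  · exact continuousOn_finsetProd _ fun k _ =>
      (hcont _).zpow₀ _ fun ξ hξ => Or.inl (hne ξ hξ _)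
  · refine continuousOn_finsetSum _ fun k _ => ?_
    exact ((continuousOn_const.mul ((hcont k).inv₀ fun ξ hξ => hne ξ hξ k)).add
      (continuousOn_const.mul (hcont k))).sub continuousOn_const
  · exact continuousOn_const

/-- The defect of the boundary condition at the level of integrands is antisymmetric under
composition with the adjacent transposition. -/
theorem betheIntegrand_defect_add_swap {N : ℕ} {p q : ℂ} (y X : Fin N → ℤ) (t : ℝ)
    (σ : Equiv.Perm (Fin N)) {i j : Fin N} (hij : (j : ℕ) = i + 1) (hX : X j = X i + 1)
    {ξ : Fin N → ℂ} (h0 : ∀ k, ξ k ≠ 0) (hden : ∀ k l, p + q * ξ k * ξ l - ξ l ≠ 0)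
    (D : Equiv.Perm (Fin N) → ℂ)
    (hD : ∀ τ, D τ = betheIntegrand p q y X t τ ξ -
      p * betheIntegrand p q y (Function.update X j (X i)) t τ ξ -
      q * betheIntegrand p q y (Function.update X i (X i + 1)) t τ ξ) :
    D σ + D (σ * Equiv.swap i j) = 0 := by
  have hne : i ≠ j := by rintro rfl; omega
  wlog hσ : σ i < σ j generalizing σ
  · have := this (σ * Equiv.swap i j) (by
      simpa using lt_of_le_of_ne (not_lt.mp hσ) (σ.injective.ne hne.symm))
    rwa [mul_assoc, Equiv.swap_mul_self, mul_one, add_comm] at this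
  set Z := Function.update X j (X i) with hZ
  have hZX : X = Function.update Z j (Z j + 1) := by simp [hZ, ← hX]
  have key : ∀ τ, D τ = Aperm p q ξ τ * (∏ k, ξ (τ k) ^ (Z k - y (τ k) - 1)) *
      Complex.exp ((∑ k, epsATW p q (ξ k)) * (t : ℂ)) *
      (ξ (τ j) - p - q * ξ (τ i) * ξ (τ j)) := by
    intro τ
    have h1 := prod_zpow_update_add_one y Z ξ τ j (h0 _)
    rw [← hZX] at h1
    rw [hD]
    simp only [betheIntegrand, prod_zpow_update_add_one y X ξ τ i (h0 _), h1]
    ring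
  have hs : Sfac p q (ξ (σ j)) (ξ (σ i)) * (p + q * ξ (σ j) * ξ (σ i) - ξ (σ i)) =
      -(p + q * ξ (σ j) * ξ (σ i) - ξ (σ j)) := div_mul_cancel₀ _ (hden _ _)
  rw [key, key, prod_zpow_mul_swap y Z ξ σ (by simp [hZ, hne]), Aperm_mul_swap p q ξ σ hij hσ]
  simp only [Equiv.Perm.mul_apply, Equiv.swap_apply_left, Equiv.swap_apply_right]
  linear_combination -(Aperm p q ξ σ * (∏ k, ξ (σ k) ^ (Z k - y (σ k) - 1)) *
      Complex.exp ((∑ k, epsATW p q (ξ k)) * (t : ℂ))) * hs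

/-- Boundary condition for the Bethe-ansatz formula: if the `(i+1)`-st coordinate of `X`
equals `X i + 1` (positions `i, i+1` carry the values `x_i, x_i + 1`), then
`u(…, x_i, x_i + 1, …; t) = p u(…, x_i, x_i, …; t) + q u(…, x_i + 1, x_i + 1, …; t)`. -/
theorem betheU_boundary_condition (N : ℕ) (hN : 2 ≤ N) (p q : ℝ)
    (hp0 : 0 < p) (hp1 : p < 1) (hq : q = 1 - p)
    (y : Fin N → ℤ) (hy : StrictMono y)
    (r : ℝ) (hr : 0 < r) (hrpq : r + q * r ^ 2 < p)
    (t : ℝ) (X : Fin N → ℤ) (i j : Fin N)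
    (hij : (j : ℕ) = (i : ℕ) + 1) (hX : X j = X i + 1) :
    betheU (p : ℂ) (q : ℂ) y r X t =
      (p : ℂ) * betheU (p : ℂ) (q : ℂ) y r (Function.update X j (X i)) t +
      (q : ℂ) * betheU (p : ℂ) (q : ℂ) y r (Function.update X i (X i + 1)) t := by
  have hq0 : 0 ≤ q := by linarith
  let T := fun (Y : Fin N → ℤ) (σ : Equiv.Perm (Fin N)) =>
    torusIntegral (betheIntegrand p q y Y t σ) 0 (fun _ => r)
  have hU : ∀ Y, betheU (p : ℂ) (q : ℂ) y r Y t =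
      (2 * (Real.pi : ℂ) * Complex.I)⁻¹ ^ N * ∑ σ, T Y σ := by
    intro Y
    rw [Finset.mul_sum]
    exact Finset.sum_congr rfl fun σ _ => congrArg _ (multiCircleIntegral_eq_torusIntegral hr.le
      (continuousOn_betheIntegrand hp0 hq0 hr hrpq y Y t σ))
  let D : (Fin N → ℂ) → Equiv.Perm (Fin N) → ℂ := fun ξ σ => betheIntegrand p q y X t σ ξ -
    p * betheIntegrand p q y (Function.update X j (X i)) t σ ξ -
    q * betheIntegrand p q y (Function.update X i (X i + 1)) t σ ξ
  have hint : ∀ Y σ, TorusIntegrable (betheIntegrand p q y Y t σ) 0 (fun _ => r) := fun Y σ =>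
    torusIntegrable_of_continuousOn hr.le (continuousOn_betheIntegrand hp0 hq0 hr hrpq y Y t σ)
  have hsmul : ∀ (c : ℂ) Y σ,
      TorusIntegrable (fun ξ => c * betheIntegrand p q y Y t σ ξ) 0 (fun _ => r) := fun c Y σ =>
    (hint Y σ).const_mul c
  have hDint : ∀ σ, TorusIntegrable (fun ξ => D ξ σ) 0 (fun _ => r) := fun σ =>
    ((hint X σ).sub (hsmul _ _ σ)).sub (hsmul _ _ σ)
  have hDT : ∀ σ, torusIntegral (fun ξ => D ξ σ) 0 (fun _ => r) = T X σ -
      p * T (Function.update X j (X i)) σ - q * T (Function.update X i (X i + 1)) σ := by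
    intro σ
    refine (torusIntegral_sub ((hint X σ).sub (hsmul _ _ σ)) (hsmul _ _ σ)).trans ?_
    rw [torusIntegral_const_mul]
    refine congrArg (· - _) ((torusIntegral_sub (hint X σ) (hsmul _ _ σ)).trans ?_)
    rw [torusIntegral_const_mul]
  have hne : i ≠ j := by rintro rfl; omega
  have hsum : ∑ σ, torusIntegral (fun ξ => D ξ σ) 0 (fun _ => r) = 0 := by
    refine Finset.sum_involution (fun σ _ => σ * Equiv.swap i j) (fun σ _ => ?_)
      (fun σ _ _ h => hne (Equiv.swap_eq_one_iff.mp (mul_eq_left.mp h)))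
      (fun _ _ => Finset.mem_univ _) (fun σ _ => by simp [mul_assoc])
    rw [← torusIntegral_add (hDint _) (hDint _)]
    refine (torusIntegral_congr_on_torus (g := fun _ => 0) hr.le fun ξ hξ => ?_).trans
      (by simp [torusIntegral])
    exact betheIntegrand_defect_add_swap y X t σ hij hX
      (fun k => norm_ne_zero_iff.mp ((hξ k).trans_ne hr.ne'))
      (fun k l => Sfac_denom_ne_zero hp0 hq0 hrpq (hξ k) (hξ l)) (D ξ) fun _ => rfl
  simp only [hDT, Finset.sum_sub_distrib, ← Finset.mul_sum] at hsum
  rw [hU, hU, hU]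
  linear_combination (2 * (Real.pi : ℂ) * Complex.I)⁻¹ ^ N * hsum

end
end

section
/- (Identity #2) Let m ≥ 0, N ≥ m + 1, and let p, q be complex numbers with p + q = 1 such that [j] ≠ 0 for all 1 ≤ j ≤ N − 1. Let ξ_1,…,ξ_N be pairwise distinct complex numbers. Then Σ_{S ⊆ {1,…,N}, |S| = m} [ Π_{i ∈ S, j ∈ S^c} f(i,j)/(ξ_j − ξ_i) ] · ( 1 − Π_{j ∈ S^c} ξ_j ) = q^m · [N−1 over m] · ( 1 − Π_{j=1}^N ξ_j ), where S^c denotes the complement of S in {1,…,N}. -/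
open Finset

noncomputable section

/-- The bracket number `[n] = Σ_{j=0}^{n-1} p^j q^{n-1-j}`, which equals
`(p^n - q^n)/(p - q)` when `p ≠ q` and `p + q = 1`. -/
def brk (p q : ℂ) (n : ℕ) : ℂ := ∑ j ∈ Finset.range n, p ^ j * q ^ (n - 1 - j)

/-- The bracket factorial `[n]! = [n][n-1]⋯[1]`, with `[0]! = 1`. -/
def brkFact (p q : ℂ) : ℕ → ℂ
  | 0 => 1
  | n + 1 => brk p q (n + 1) * brkFact p q n

/-- The bracket binomial coefficient `[n over m] = [n]! / ([m]! [n-m]!)`. -/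
def brkBinom (p q : ℂ) (n m : ℕ) : ℂ := brkFact p q n / (brkFact p q m * brkFact p q (n - m))

theorem brk_succ (p q : ℂ) (n : ℕ) : brk p q (n + 1) = q ^ n + p * brk p q n := by
  simp only [brk, Finset.sum_range_succ', Finset.mul_sum]
  rw [add_comm]
  congr 1
  · simp
  · refine Finset.sum_congr rfl fun j _ => ?_
    rw [show n + 1 - 1 - (j + 1) = n - 1 - j by omega]
    ring

theorem brk_succ' (p q : ℂ) (n : ℕ) : brk p q (n + 1) = p ^ n + q * brk p q n := by
  simp only [brk, Finset.sum_range_succ, Finset.mul_sum]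
  rw [add_comm]
  congr 1
  · simp
  · refine Finset.sum_congr rfl fun j hj => ?_
    have := Finset.mem_range.1 hj
    rw [show n + 1 - 1 - j = (n - 1 - j) + 1 by omega]
    ring

theorem brkFact_ne_zero {p q : ℂ} {n : ℕ} (h : ∀ j, 1 ≤ j → j ≤ n → brk p q j ≠ 0) :
    brkFact p q n ≠ 0 := by
  induction n with
  | zero => simp [brkFact]
  | succ n ih =>
    exact mul_ne_zero (h _ (by omega) le_rfl) (ih fun j h1 h2 => h j h1 (by omega))

/-- The weight `f(x, y) / (y - x)` of a pair. -/
def pairWeight (p q x y : ℂ) : ℂ := (p + q * x * y - x) / (y - x)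

theorem pairWeight_one_left {p q y : ℂ} (hpq : p + q = 1) (hy : y ≠ 1) :
    pairWeight p q 1 y = q := by
  rw [pairWeight, div_eq_iff (sub_ne_zero.2 hy)]
  linear_combination hpq

open Polynomial in
/-- Lagrange interpolation of `∏ y ∈ T, f(·, y)` at the nodes `insert 1 T`, evaluated at `z`. -/
theorem prod_pairWeight_sub_pow {p q z : ℂ} (hpq : p + q = 1) {T : Finset ℂ}
    (h1 : 1 ∉ T) (hz : z ∉ T) (hz1 : z ≠ 1) :
    ∏ y ∈ T, pairWeight p q z y - q ^ #T =
      ∑ x ∈ T, (z - 1) * (p - q * x) / (z - x) * ∏ y ∈ T.erase x, pairWeight p q x y := by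
  set P : ℂ[X] := ∏ y ∈ T, (C (1 - q * y) * X + C (-p)) with hP
  have hdeg : P.natDegree ≤ #T := by
    refine (natDegree_prod_le _ _).trans ((Finset.sum_le_card_nsmul _ _ 1 fun y _ => ?_).trans ?_)
    · exact natDegree_linear_le
    · simp
  have hz' : z ∉ insert 1 T := by simp [hz, hz1]
  have hcard : #(insert z (insert 1 T)) = #T + 2 := by
    rw [card_insert_of_notMem hz', card_insert_of_notMem h1]
  have hLag := Lagrange.coeff_eq_sum (s := insert z (insert 1 T)) (v := (id : ℂ → ℂ))
    Function.injective_id.injOn (P := P) (by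
      rw [hcard]
      exact degree_le_natDegree.trans_lt (by exact_mod_cast (by omega)))
  have hweight (x y : ℂ) : ((1 - q * y) * x + -p) / (x - y) = pairWeight p q x y := by
    rw [pairWeight, ← neg_sub x y, div_neg, ← neg_div]
    congr 1
    ring
  have heval (x : ℂ) : P.eval x = ∏ y ∈ T, ((1 - q * y) * x + -p) := by
    simp [hP, eval_prod]
  rw [coeff_eq_zero_of_natDegree_lt (by omega), sum_insert hz', sum_insert h1,
    erase_insert hz', prod_insert h1, erase_insert_of_ne hz1, erase_insert h1,
    prod_insert hz] at hLag
  simp only [id, heval] at hLag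
  have hsub : z - 1 ≠ 0 := sub_ne_zero.2 hz1
  have hfirst : (∏ y ∈ T, ((1 - q * y) * z + -p)) / ((z - 1) * ∏ y ∈ T, (z - y)) =
      (∏ y ∈ T, pairWeight p q z y) / (z - 1) := by
    simp only [← hweight, prod_div_distrib]
    rw [div_div, mul_comm]
  have hsecond : (∏ y ∈ T, ((1 - q * y) * 1 + -p)) / ((1 - z) * ∏ y ∈ T, (1 - y)) =
      - (q ^ #T / (z - 1)) := by
    have hprod : ∏ y ∈ T, pairWeight p q 1 y = q ^ #T := by
      rw [← prod_const]
      exact prod_congr rfl fun y hy =>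
        pairWeight_one_left hpq fun h => h1 (h ▸ hy)
    rw [← hprod]
    simp only [← hweight, prod_div_distrib]
    rw [← neg_sub z 1, neg_mul, div_neg, div_div, mul_comm (z - 1)]
  have hrest : ∑ x ∈ T, (∏ y ∈ T, ((1 - q * y) * x + -p)) /
        ∏ y ∈ (insert z (insert 1 T)).erase x, (x - y) =
      - ((∑ x ∈ T, (z - 1) * (p - q * x) / (z - x) *
        ∏ y ∈ T.erase x, pairWeight p q x y) / (z - 1)) := by
    rw [sum_div, ← sum_neg_distrib]
    refine sum_congr rfl fun x hx => ?_
    have hxz : z ≠ x := fun h => hz (h ▸ hx)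
    have hx1 : 1 ≠ x := fun h => h1 (h ▸ hx)
    rw [erase_insert_of_ne hxz, erase_insert_of_ne hx1,
      prod_insert (fun h => hz' (mem_insert.2 ((mem_insert.1 h).imp id mem_of_mem_erase))),
      prod_insert (fun h => h1 (mem_of_mem_erase h)), ← mul_prod_erase T _ hx]
    simp only [← hweight, prod_div_distrib]
    have h2 : z - x ≠ 0 := sub_ne_zero.2 hxz
    have h3 : x - z ≠ 0 := sub_ne_zero.2 hxz.symm
    have h4 : x - 1 ≠ 0 := sub_ne_zero.2 hx1.symm
    have h5 : ∏ y ∈ T.erase x, (x - y) ≠ 0 :=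
      prod_ne_zero_iff.2 fun y hy => sub_ne_zero.2 (ne_of_mem_erase hy).symm
    have h6 : (1 - q * x) * x + -p = (x - 1) * (p - q * x) := by
      linear_combination -x * hpq
    rw [h6]
    generalize ∏ y ∈ T.erase x, (x - y) = A at *
    generalize ∏ y ∈ T.erase x, ((1 - q * y) * x + -p) = B at *
    rw [← neg_sub z x]
    field_simp
  rw [hfirst, hsecond, hrest] at hLag
  generalize ∑ x ∈ T, (z - 1) * (p - q * x) / (z - x) *
    ∏ y ∈ T.erase x, pairWeight p q x y = A at *
  field_simp at hLag
  linear_combination -hLag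

theorem sum_prod_erase_insert {R : Type*} [CommRing R] (g : ℂ → ℂ → R) (h : ℂ → R) {k : ℂ}
    {T : Finset ℂ} (hk : k ∉ T) :
    ∑ x ∈ insert k T, (∏ y ∈ (insert k T).erase x, g x y) *
        ∏ y ∈ (insert k T).erase x, h y =
      (∏ y ∈ T, g k y) * ∏ y ∈ T, h y +
        ∑ x ∈ T, g x k * h k * ((∏ y ∈ T.erase x, g x y) * ∏ y ∈ T.erase x, h y) := by
  rw [sum_insert hk, erase_insert hk]
  congr 1
  refine sum_congr rfl fun x hx => ?_
  rw [erase_insert_of_ne (by rintro rfl; exact hk hx),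
    prod_insert (fun h => hk (mem_of_mem_erase h)),
    prod_insert (fun h => hk (mem_of_mem_erase h))]
  ring

theorem sum_prod_pairWeight_insert {p q k : ℂ} (hpq : p + q = 1) {T : Finset ℂ}
    (h1 : 1 ∉ T) (hk : k ∉ T) :
    ∑ x ∈ insert k T, ∏ y ∈ (insert k T).erase x, pairWeight p q x y =
      q ^ #T + p * ∑ x ∈ T, ∏ y ∈ T.erase x, pairWeight p q x y := by
  have hins := sum_prod_erase_insert (pairWeight p q) (fun _ => 1) hk
  simp only [prod_const_one, mul_one] at hins
  rw [hins, mul_sum]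
  have hne {x : ℂ} (hx : x ∈ T) : k - x ≠ 0 := sub_ne_zero.2 fun h => hk (h ▸ hx)
  suffices h : ∏ y ∈ T, pairWeight p q k y - q ^ #T =
      ∑ x ∈ T, (k - 1) * (p - q * x) / (k - x) * ∏ y ∈ T.erase x, pairWeight p q x y by
    rw [← sub_eq_iff_eq_add', add_sub_right_comm, h, ← sum_add_distrib]
    refine sum_congr rfl fun x hx => ?_
    rw [← add_mul, pairWeight]
    congr 1
    have := hne hx
    field_simp
    linear_combination x * hpq
  by_cases hk1 : k = 1
  · subst hk1
    simp only [sub_self, zero_mul, zero_div, sum_const_zero, sub_eq_zero]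
    rw [← prod_const]
    exact prod_congr rfl fun y hy => pairWeight_one_left hpq fun h => h1 (h ▸ hy)
  · exact prod_pairWeight_sub_pow hpq h1 hk hk1

theorem sum_prod_pairWeight {p q : ℂ} (hpq : p + q = 1) (T : Finset ℂ) :
    ∑ x ∈ T, ∏ y ∈ T.erase x, pairWeight p q x y = brk p q #T := by
  induction hn : #T generalizing T with
  | zero => simp [card_eq_zero.1 hn, brk]
  | succ n ih =>
    obtain ⟨k, hk, h1⟩ : ∃ k ∈ T, 1 ∉ T.erase k := by
      by_cases h1 : 1 ∈ T
      · exact ⟨1, h1, notMem_erase _ _⟩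
      · obtain ⟨k, hk⟩ := card_pos.1 (by omega : 0 < #T)
        exact ⟨k, hk, fun h => h1 (mem_of_mem_erase h)⟩
    have hcard : #(T.erase k) = n := by rw [card_erase_of_mem hk]; omega
    have h := sum_prod_pairWeight_insert hpq h1 (notMem_erase k T)
    rw [insert_erase hk, hcard, ih _ hcard] at h
    rw [h, brk_succ]

theorem sum_prod_pairWeight_mul_prod {p q : ℂ} (hpq : p + q = 1) {n : ℕ} {T : Finset ℂ}
    (hT : #T = n + 1) :
    ∑ x ∈ T, (∏ y ∈ T.erase x, pairWeight p q x y) * ∏ y ∈ T.erase x, y =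
      q * brk p q n * ∏ y ∈ T, y + p ^ n := by
  induction n generalizing T with
  | zero =>
    obtain ⟨k, rfl⟩ := card_eq_one.1 hT
    simp [brk]
  | succ n ih =>
    obtain ⟨k, S, hk, rfl, hS⟩ := card_eq_succ.1 hT
    have hsum := sum_prod_erase_insert (pairWeight p q) (fun _ => 1) hk
    simp only [prod_const_one, mul_one] at hsum
    rw [sum_prod_pairWeight hpq, hT] at hsum
    have hterm : ∀ x ∈ S, pairWeight p q x k * k *
          ((∏ y ∈ S.erase x, pairWeight p q x y) * ∏ y ∈ S.erase x, y) =
        (∏ y ∈ S, y) * (pairWeight p q x k * ∏ y ∈ S.erase x, pairWeight p q x y) +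
          p * ((∏ y ∈ S.erase x, pairWeight p q x y) * ∏ y ∈ S.erase x, y) +
          (q * k - 1) * (∏ y ∈ S, y) * ∏ y ∈ S.erase x, pairWeight p q x y := by
      intro x hx
      have hne : k - x ≠ 0 := sub_ne_zero.2 fun h => hk (h ▸ hx)
      rw [← mul_prod_erase S (fun y => y) hx]
      have hf : pairWeight p q x k * (k - x) = p + q * x * k - x := div_mul_cancel₀ _ hne
      linear_combination (∏ y ∈ S.erase x, pairWeight p q x y) * (∏ y ∈ S.erase x, y) * hf
    rw [sum_prod_erase_insert (pairWeight p q) (fun y => y) hk, sum_congr rfl hterm,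
      sum_add_distrib, sum_add_distrib, ← mul_sum, ← mul_sum, ← mul_sum, ih hS,
      sum_prod_pairWeight hpq, hS, prod_insert hk]
    linear_combination (∏ y ∈ S, y) * (-hsum + brk_succ p q (n + 1)) +
      (∏ y ∈ S, y) * (-1 + p) * brk_succ p q n + (∏ y ∈ S, y) * q ^ n * hpq +
      (∏ y ∈ S, y) * p * brk p q n * hpq

theorem sum_powersetCard_succ_sum {α M : Type*} [DecidableEq α] [AddCommMonoid M] (m : ℕ)
    (T : Finset α) (g : Finset α → α → M) :
    ∑ S ∈ powersetCard (m + 1) T, ∑ x ∈ S, g S x =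
      ∑ x ∈ T, ∑ S ∈ powersetCard m (T.erase x), g (insert x S) x := by
  rw [sum_sigma', sum_sigma']
  refine sum_bij' (fun a _ => ⟨a.2, a.1.erase a.2⟩) (fun b _ => ⟨insert b.1 b.2, b.1⟩) ?_ ?_ ?_ ?_ ?_
  · rintro ⟨S, x⟩ h
    simp only [mem_sigma, mem_powersetCard] at h ⊢
    exact ⟨h.1.1 h.2, erase_subset_erase _ h.1.1, by rw [card_erase_of_mem h.2, h.1.2]; rfl⟩
  · rintro ⟨x, S⟩ h
    simp only [mem_sigma, mem_powersetCard] at h ⊢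
    have hx : x ∉ S := fun hx => notMem_erase x T (h.2.1 hx)
    exact ⟨⟨insert_subset h.1 (h.2.1.trans (erase_subset _ _)),
      by rw [card_insert_of_notMem hx, h.2.2]⟩, mem_insert_self _ _⟩
  · rintro ⟨S, x⟩ h
    simp only [mem_sigma] at h
    simp [insert_erase h.2]
  · rintro ⟨x, S⟩ h
    simp only [mem_sigma, mem_powersetCard] at h
    have hx : x ∉ S := fun hx => notMem_erase x T (h.2.1 hx)
    simp [erase_insert hx]
  · rintro ⟨S, x⟩ h
    simp only [mem_sigma] at h
    simp [insert_erase h.2]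

theorem brk_mul_sum_powersetCard_succ {p q : ℂ} (hpq : p + q = 1) (m : ℕ) (T : Finset ℂ)
    (φ : Finset ℂ → ℂ) :
    brk p q (m + 1) * ∑ S ∈ powersetCard (m + 1) T,
        (∏ x ∈ S, ∏ y ∈ T \ S, pairWeight p q x y) * φ (T \ S) =
      ∑ x ∈ T, (∏ y ∈ T.erase x, pairWeight p q x y) * ∑ S ∈ powersetCard m (T.erase x),
        (∏ x' ∈ S, ∏ y ∈ T.erase x \ S, pairWeight p q x' y) * φ (T.erase x \ S) := by
  have hleft : brk p q (m + 1) * ∑ S ∈ powersetCard (m + 1) T,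
        (∏ x ∈ S, ∏ y ∈ T \ S, pairWeight p q x y) * φ (T \ S) =
      ∑ S ∈ powersetCard (m + 1) T, ∑ x ∈ S, (∏ y ∈ S.erase x, pairWeight p q x y) *
        ((∏ x ∈ S, ∏ y ∈ T \ S, pairWeight p q x y) * φ (T \ S)) := by
    rw [mul_sum]
    refine sum_congr rfl fun S hS => ?_
    rw [← sum_mul, sum_prod_pairWeight hpq, (mem_powersetCard.1 hS).2]
  rw [hleft, sum_powersetCard_succ_sum]
  refine sum_congr rfl fun x _ => ?_
  rw [mul_sum]
  refine sum_congr rfl fun S hS => ?_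
  have hST := (mem_powersetCard.1 hS).1
  have hx : x ∉ S := fun hx => notMem_erase x T (hST hx)
  have hsdiff : T \ insert x S = T.erase x \ S := by
    ext y
    simp only [mem_sdiff, mem_insert, mem_erase]
    tauto
  rw [erase_insert hx, prod_insert hx, hsdiff,
    ← prod_sdiff (f := fun y => pairWeight p q x y) hST]
  ring

theorem sum_powersetCard_pairWeight {p q : ℂ} (hpq : p + q = 1) {m n : ℕ} (hmn : m ≤ n)
    (hbrk : ∀ j, 1 ≤ j → j ≤ n → brk p q j ≠ 0) {T : Finset ℂ} (hT : #T = n + 1) :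
    ∑ S ∈ powersetCard m T,
        (∏ x ∈ S, ∏ y ∈ T \ S, pairWeight p q x y) * (1 - ∏ y ∈ T \ S, y) =
      q ^ m * brkBinom p q n m * (1 - ∏ y ∈ T, y) := by
  induction m generalizing n T with
  | zero =>
    have := brkFact_ne_zero hbrk
    simp [brkBinom, brkFact, this]
  | succ m ih =>
    obtain ⟨n, rfl⟩ : ∃ l, n = l + 1 := ⟨n - 1, by omega⟩
    have hm := hbrk (m + 1) (by omega) hmn
    refine mul_left_cancel₀ hm ?_
    rw [brk_mul_sum_powersetCard_succ hpq m T fun U => 1 - ∏ y ∈ U, y]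
    have hstep : ∀ x ∈ T, (∏ y ∈ T.erase x, pairWeight p q x y) *
          ∑ S ∈ powersetCard m (T.erase x),
            (∏ x' ∈ S, ∏ y ∈ T.erase x \ S, pairWeight p q x' y) *
              (1 - ∏ y ∈ T.erase x \ S, y) =
        q ^ m * brkBinom p q n m * (∏ y ∈ T.erase x, pairWeight p q x y -
          (∏ y ∈ T.erase x, pairWeight p q x y) * ∏ y ∈ T.erase x, y) := by
      intro x hx
      rw [ih (n := n) (by omega) (fun j h1 h2 => hbrk j h1 (by omega))
        (by rw [card_erase_of_mem hx, hT]; rfl)]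
      ring
    have hbinom : brk p q (m + 1) * brkBinom p q (n + 1) (m + 1) =
        brk p q (n + 1) * brkBinom p q n m := by
      rw [brkBinom, brkBinom, Nat.add_sub_add_right, brkFact, brkFact]
      have h1 : brkFact p q m ≠ 0 :=
        brkFact_ne_zero fun j h1 h2 => hbrk j h1 (by omega)
      have h2 : brkFact p q (n - m) ≠ 0 :=
        brkFact_ne_zero fun j h1 h2 => hbrk j h1 (by omega)
      field_simp
    rw [sum_congr rfl hstep, ← mul_sum, sum_sub_distrib, sum_prod_pairWeight hpq, hT,
      sum_prod_pairWeight_mul_prod hpq hT]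
    linear_combination q ^ m * brkBinom p q n m * brk_succ' p q (n + 1) -
      q ^ (m + 1) * (1 - ∏ y ∈ T, y) * hbinom

/-- Identity #2 of Tracy–Widom: with `f(i,j) = p + q ξ_i ξ_j - ξ_i`, for `N ≥ m + 1`,
`Σ_{|S| = m} Π_{i ∈ S, j ∈ Sᶜ} (f(i,j)/(ξ_j - ξ_i)) (1 - Π_{j ∈ Sᶜ} ξ_j)
  = q^m [N-1 over m] (1 - Π_{j=1}^N ξ_j)`. -/
theorem tracy_widom_identity_two (N m : ℕ) (hm : m + 1 ≤ N)
    (p q : ℂ) (hpq : p + q = 1)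
    (hbrk : ∀ j : ℕ, 1 ≤ j → j ≤ N - 1 → brk p q j ≠ 0)
    (ξ : Fin N → ℂ) (hξ : Function.Injective ξ) :
    ∑ S ∈ Finset.powersetCard m (Finset.univ : Finset (Fin N)),
      (∏ i ∈ S, ∏ j ∈ Sᶜ, (p + q * ξ i * ξ j - ξ i) / (ξ j - ξ i)) *
        (1 - ∏ j ∈ Sᶜ, ξ j) =
      q ^ m * brkBinom p q (N - 1) m * (1 - ∏ j : Fin N, ξ j) := by
  classical
  obtain ⟨n, rfl⟩ : ∃ n, N = n + 1 := ⟨N - 1, by omega⟩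
  let e : Fin (n + 1) ↪ ℂ := ⟨ξ, hξ⟩
  have h := sum_powersetCard_pairWeight hpq (m := m) (n := n) (by omega) hbrk
    (T := univ.map e) (by simp)
  rw [powersetCard_map, sum_map, prod_map] at h
  rw [Nat.add_sub_cancel]
  refine Eq.trans (sum_congr rfl fun S _ => ?_) h
  change _ = (∏ x ∈ S.map e, ∏ y ∈ univ.map e \ S.map e, pairWeight p q x y) *
    (1 - ∏ y ∈ univ.map e \ S.map e, y)
  rw [← Finset.map_sdiff, ← compl_eq_univ_sdiff]
  simp only [prod_map]
  rfl

end
end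

section
/- (TASEP determinant form of the Bethe sum) Let N ≥ 1 and take p = 1, q = 0. Let ξ_1,…,ξ_N be nonzero complex numbers with ξ_α ≠ 1 for all α, and let x_1,…,x_N and y_1,…,y_N be integers. Then Σ_{σ∈S_N} A_σ · Π_{i=1}^N ξ_{σ(i)}^{x_i − y_{σ(i)} − 1} = det( ( (1 − ξ_j)^{j − i} · ξ_j^{x_i − y_j − 1} )_{1 ≤ i, j ≤ N} ). -/
open Finset

noncomputable section

/-- The number of inversions with first index `k`, minus the number with second index `k`,
is the displacement of `k`. -/
theorem card_inversions_sub_card_inversions {N : ℕ} (σ : Equiv.Perm (Fin N)) (k : Fin N) :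
    ((univ.filter fun j => k < j ∧ σ j < σ k).card : ℤ) -
      ((univ.filter fun i => i < k ∧ σ k < σ i).card : ℤ) = ((σ k : ℕ) : ℤ) - ((k : ℕ) : ℤ) := by
  have hσ : (univ.filter fun j => σ j < σ k).card = (σ k : ℕ) := by
    rw [← Fin.card_Iio (σ k)]
    exact card_bij (fun j _ => σ j) (by simp) (by simp)
      fun b hb => ⟨σ.symm b, by simpa using hb, by simp⟩
  have hk : (univ.filter fun i => i < k).card = (k : ℕ) := by
    rw [← Fin.card_Iio k]
    congr 1
    ext i
    simp
  have hσ_split := card_filter_add_card_filter_not (s := univ.filter fun j => σ j < σ k)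
    (fun j => k < j)
  have hk_split := card_filter_add_card_filter_not (s := univ.filter fun i => i < k)
    (fun i => σ k < σ i)
  simp only [filter_filter] at hσ_split hk_split
  have hcommon : (univ.filter fun j => σ j < σ k ∧ ¬k < j) =
      univ.filter fun i => i < k ∧ ¬σ k < σ i := by
    ext j
    have hj : σ j = σ k ↔ j = k := σ.injective.eq_iff
    simp only [mem_filter, mem_univ, true_and]
    grind
  have hcomm : (univ.filter fun j => k < j ∧ σ j < σ k) =
      univ.filter fun j => σ j < σ k ∧ k < j := by
    simp only [and_comm]
  rw [hcommon] at hσ_split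
  rw [hcomm]
  lia

theorem sign_eq_prod_inversions {N : ℕ} (σ : Equiv.Perm (Fin N)) :
    ((Equiv.Perm.sign σ : ℤ) : ℂ) =
      ∏ _pr ∈ univ.filter (fun pr : Fin N × Fin N => pr.1 < pr.2 ∧ σ pr.2 < σ pr.1), (-1 : ℂ) := by
  rw [σ.sign_eq_prod_prod_Ioi, prod_filter, Fintype.prod_prod_type]
  push_cast
  refine prod_congr rfl fun i _ => ?_
  rw [← filter_lt_eq_Ioi, prod_filter]
  refine prod_congr rfl fun j _ => ?_
  have hij : σ i = σ j ↔ i = j := σ.injective.eq_iff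
  split_ifs <;> first | (exfalso; grind) | simp

theorem Aperm_one_zero {N : ℕ} (ξ : Fin N → ℂ) (hξ1 : ∀ a : Fin N, ξ a ≠ 1)
    (σ : Equiv.Perm (Fin N)) :
    Aperm 1 0 ξ σ = ((Equiv.Perm.sign σ : ℤ) : ℂ) *
      ∏ i, (1 - ξ (σ i)) ^ (((σ i : ℕ) : ℤ) - ((i : ℕ) : ℤ)) := by
  have hS : ∀ a b : ℂ, Sfac 1 0 a b = -1 * ((1 - a) / (1 - b)) := fun a b => by
    simp [Sfac]
    ring
  simp only [Aperm, hS]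
  rw [prod_mul_distrib, ← sign_eq_prod_inversions, prod_div_distrib]
  congr 1
  rw [prod_filter, prod_filter, Fintype.prod_prod_type, Fintype.prod_prod_type_right]
  simp only [← prod_filter, prod_const]
  rw [← prod_div_distrib]
  refine prod_congr rfl fun k _ => ?_
  rw [← card_inversions_sub_card_inversions σ k, zpow_sub₀ (sub_ne_zero.2 (hξ1 _).symm),
    zpow_natCast, zpow_natCast]

/-- TASEP determinant form of the Bethe sum: for `p = 1`, `q = 0`,
`Σ_σ A_σ Π_i ξ_{σ(i)}^{x_i - y_{σ(i)} - 1}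
  = det( (1 - ξ_j)^{j-i} ξ_j^{x_i - y_j - 1} )_{1 ≤ i,j ≤ N}`. -/
theorem tasep_bethe_sum_determinant (N : ℕ) (hN : 1 ≤ N) (ξ : Fin N → ℂ)
    (hξ0 : ∀ a : Fin N, ξ a ≠ 0) (hξ1 : ∀ a : Fin N, ξ a ≠ 1)
    (x y : Fin N → ℤ) :
    ∑ σ : Equiv.Perm (Fin N),
      Aperm 1 0 ξ σ * ∏ i : Fin N, ξ (σ i) ^ (x i - y (σ i) - 1) =
      Matrix.det (Matrix.of fun i j : Fin N =>
        (1 - ξ j) ^ (((j : ℕ) : ℤ) - ((i : ℕ) : ℤ)) * ξ j ^ (x i - y j - 1)) := by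
  rw [← Matrix.det_transpose, Matrix.det_apply']
  refine sum_congr rfl fun σ _ => ?_
  rw [Aperm_one_zero ξ hξ1, mul_assoc, ← prod_mul_distrib]
  rfl

end
end
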